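/- Let M = ⊕_{m ≥ 0, m ∈ (1/T)ℤ} M(m) be a simple admissible g-twisted V-module with M(0) ≠ 0, and let n ∈ (1/T)ℤ be nonnegative. Then each M(i) for i = 0, 1/T, …, n is a simple A_{g,n}(V)-module (via the action a ↦ o(a) = a_{wt a − 1}), and M(i) and M(j) are inequivalent A_{g,n}(V)-modules for i ≠ j. -/

import Mathlib

/-
Common framework for formalizing
"Twisted representations of vertex operator algebras and associative algebras"
by C. Dong, H. Li, G. Mason.

We formalize a vertex operator algebra `V` over `ℂ` through its modes
`u_m = mode u m` (`m : ℤ`), vacuum `𝟏`, conformal vector `ω` (so that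
`L(n) = ω_{n+1}`), a weight grading `wtSpace`, and the Borcherds identity.
An automorphism `g` of finite order `T` gives eigenspaces
`V^r = eigSpace V g T r`.  For `n = l + i/T` the subspace `O_{g,n}(V)` is
`Ogn V g T l i`, the product `*_{g,n}` is `starMul V g T l`
(it only depends on `l`), and `A_{g,n}(V) = V.carrier ⧸ Ogn V g T l i`.
-/

noncomputable section

open scoped BigOperators

namespace DLM

/-- Generalized binomial coefficient `binom(α, j)` for a rational `α`. -/
def qchoose (α : ℚ) (j : ℕ) : ℚ :=
  (∏ k ∈ Finset.range j, (α - (k : ℚ))) / (Nat.factorial j : ℚ)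

/-- A vertex operator algebra over `ℂ`, given by its modes `u_m v = mode u m v`
(the coefficients of `Y(u,z)v`), the vacuum `𝟏`, the conformal vector `ω`
(with `L(n) = ω_{n+1}`), and the integer weight grading. -/
structure VOA where
  carrier : Type
  [acg : AddCommGroup carrier]
  [mod : Module ℂ carrier]
  mode : carrier →ₗ[ℂ] (ℤ → carrier →ₗ[ℂ] carrier)
  vacuum : carrier
  conformal : carrier
  wtSpace : ℤ → Submodule ℂ carrier
  [decomp : DirectSum.Decomposition wtSpace]
  findim : ∀ k : ℤ, FiniteDimensional ℂ (wtSpace k)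
  bounded_below : ∃ N : ℤ, ∀ k : ℤ, k < N → wtSpace k = ⊥
  trunc : ∀ u v : carrier, ∃ N : ℤ, ∀ m : ℤ, N ≤ m → mode u m v = 0
  vacuum_wt : vacuum ∈ wtSpace 0
  conformal_wt : conformal ∈ wtSpace 2
  vacuum_mode : ∀ (m : ℤ) (v : carrier), mode vacuum m v = if m = -1 then v else 0
  creation₁ : ∀ u : carrier, mode u (-1) vacuum = u
  creation₂ : ∀ (u : carrier) (m : ℤ), 0 ≤ m → mode u m vacuum = 0
  L0_grading : ∀ (k : ℤ), ∀ v ∈ wtSpace k, mode conformal 1 v = (k : ℂ) • v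
  mode_grading : ∀ (a b m : ℤ) (u v : carrier), u ∈ wtSpace a → v ∈ wtSpace b →
    mode u m v ∈ wtSpace (a + b - m - 1)
  Lneg1_mode : ∀ (u : carrier) (m : ℤ),
    mode (mode conformal 0 u) m = (-(m : ℂ)) • (mode u (m - 1))
  borcherds : ∀ (u v w : carrier) (p q s : ℤ),
    ∑ᶠ j : ℕ, ((qchoose (p : ℚ) j : ℚ) : ℂ) • mode (mode u (s + j) v) (p + q - j) w =
    ∑ᶠ j : ℕ, ((-1 : ℂ) ^ j * ((qchoose (s : ℚ) j : ℚ) : ℂ)) •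
      (mode u (p + s - j) (mode v (q + j) w)
        - ((-1 : ℂ) ^ s) • mode v (q + s - j) (mode u (p + j) w))

attribute [instance] VOA.acg VOA.mod VOA.decomp

namespace VOA

/-- Projection of `u` onto its weight `k` homogeneous component. -/
def proj (V : VOA) (k : ℤ) (u : V.carrier) : V.carrier :=
  (((DirectSum.decompose V.wtSpace u) k : V.wtSpace k) : V.carrier)

/-- `res V α β u v = Res_z Y(u,z)v (1+z)^α z^{-β}
  = ∑_{j ≥ 0} binom(α, j) u_{j - β} v`. -/
def res (V : VOA) (α : ℚ) (β : ℤ) (u v : V.carrier) : V.carrier :=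
  ∑ᶠ j : ℕ, ((qchoose α j : ℚ) : ℂ) • V.mode u ((j : ℤ) - β) v

end VOA

/-- An automorphism of a vertex operator algebra. -/
structure VOAAut (V : VOA) where
  lin : V.carrier ≃ₗ[ℂ] V.carrier
  map_vacuum : lin V.vacuum = V.vacuum
  map_conformal : lin V.conformal = V.conformal
  map_mode : ∀ (u : V.carrier) (m : ℤ) (v : V.carrier),
    lin (V.mode u m v) = V.mode (lin u) m (lin v)
  map_wt : ∀ (k : ℤ) (u : V.carrier), u ∈ V.wtSpace k ↔ lin u ∈ V.wtSpace k

/-- The inverse automorphism `g⁻¹`. -/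
def VOAAut.symm {V : VOA} (g : VOAAut V) : VOAAut V where
  lin := g.lin.symm
  map_vacuum := g.lin.injective (by rw [LinearEquiv.apply_symm_apply, g.map_vacuum])
  map_conformal := g.lin.injective (by rw [LinearEquiv.apply_symm_apply, g.map_conformal])
  map_mode := fun u m v => g.lin.injective (by
    rw [LinearEquiv.apply_symm_apply, g.map_mode, LinearEquiv.apply_symm_apply,
      LinearEquiv.apply_symm_apply])
  map_wt := fun k u => by
    have h := (g.map_wt k (g.lin.symm u)).symm
    rwa [LinearEquiv.apply_symm_apply] at h

/-- The eigenspace `V^r = {v ∈ V | g v = e^{-2πir/T} v}`. -/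
def eigSpace (V : VOA) (g : VOAAut V) (T r : ℕ) : Submodule ℂ V.carrier where
  carrier := {v | g.lin v =
    Complex.exp (-(2 * (Real.pi : ℂ) * Complex.I * (r : ℂ)) / (T : ℂ)) • v}
  add_mem' := fun {a b} ha hb => by
    simp only [Set.mem_setOf_eq] at *
    rw [map_add, ha, hb, smul_add]
  zero_mem' := by simp
  smul_mem' := fun c a ha => by
    simp only [Set.mem_setOf_eq] at *
    rw [map_smul, ha, smul_comm]

/-- `δ_i(r)`: equals `1` if `r ≤ i` or `r = T`, and `0` otherwise. -/
def deltaI (T i r : ℕ) : ℕ := if r ≤ i ∨ r = T then 1 else 0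

/-- `O_{g,n}(V)` for `n = l + i/T`: the span of all `L(-1)u + L(0)u` and all
`u ∘_{g,n} v = Res_z Y(u,z)v (1+z)^{wt u - 1 + δ_i(r) + l + r/T}
 / z^{2l + δ_i(r) + δ_i(T-r)}` for homogeneous `u ∈ V^r`. -/
def Ogn (V : VOA) (g : VOAAut V) (T l i : ℕ) : Submodule ℂ V.carrier :=
  Submodule.span ℂ
    ({x | ∃ u : V.carrier, x = V.mode V.conformal 0 u + V.mode V.conformal 1 u} ∪
     {x | ∃ r : ℕ, r < T ∧ ∃ (k : ℤ) (u v : V.carrier),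
        u ∈ V.wtSpace k ∧ u ∈ eigSpace V g T r ∧
        x = V.res ((k : ℚ) - 1 + (deltaI T i r : ℚ) + (l : ℚ) + (r : ℚ) / (T : ℚ))
              (2 * (l : ℤ) + (deltaI T i r : ℤ) + (deltaI T i (T - r) : ℤ)) u v})

/-- The product `u *_{g,n} v` for `u` homogeneous of weight `k` in `V^0`:
`∑_{m=0}^{l} (-1)^m binom(m+l, l) Res_z Y(u,z) (1+z)^{wt u + l} z^{-(l+m+1)} v`. -/
def starFor (V : VOA) (l : ℕ) (k : ℤ) (u v : V.carrier) : V.carrier :=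
  ∑ m ∈ Finset.range (l + 1),
    ((-1 : ℂ) ^ m * (Nat.choose (m + l) l : ℂ)) •
      V.res ((k : ℚ) + (l : ℚ)) ((l : ℤ) + (m : ℤ) + 1) u v

/-- Projection onto the eigenspace `V^r` of the finite order automorphism `g`. -/
def eigProj (V : VOA) (g : VOAAut V) (T r : ℕ) (v : V.carrier) : V.carrier :=
  (T : ℂ)⁻¹ • ∑ t ∈ Finset.range T,
    Complex.exp ((2 * (Real.pi : ℂ) * Complex.I * (r : ℂ) * (t : ℂ)) / (T : ℂ)) •
      ((g.lin ^ t) v)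

/-- The bilinear extension of `*_{g,n}` to all of `V` (it vanishes when the first
argument is homogeneous in `V^r`, `r ≠ 0`, and only depends on `l`). -/
def starMul (V : VOA) (g : VOAAut V) (T l : ℕ) (u v : V.carrier) : V.carrier :=
  ∑ᶠ k : ℤ, starFor V l k (eigProj V g T 0 (V.proj k u)) v

/-- The subspace `O_{1,l}(V^0)` of the untwisted theory of the fixed point
subalgebra `V^0` (all `δ` terms equal `1`), viewed inside `V`. -/
def OgnV0 (V : VOA) (g : VOAAut V) (T l : ℕ) : Submodule ℂ V.carrier :=
  Submodule.span ℂ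
    ({x | ∃ u ∈ eigSpace V g T 0, x = V.mode V.conformal 0 u + V.mode V.conformal 1 u} ∪
     {x | ∃ (k : ℤ) (u v : V.carrier),
        u ∈ V.wtSpace k ∧ u ∈ eigSpace V g T 0 ∧ v ∈ eigSpace V g T 0 ∧
        x = V.res ((k : ℚ) + (l : ℚ)) (2 * (l : ℤ) + 2) u v})

/-- `e^{L(1)} v` (where `L(1) = ω_2`). -/
def expL1 (V : VOA) (v : V.carrier) : V.carrier :=
  ∑ᶠ j : ℕ, ((Nat.factorial j : ℂ))⁻¹ • ((fun w => V.mode V.conformal 2 w)^[j] v)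

/-- The map `φ : v ↦ e^{L(1)} (-1)^{L(0)} v`. -/
def phiMap (V : VOA) (v : V.carrier) : V.carrier :=
  ∑ᶠ k : ℤ, ((-1 : ℂ) ^ k) • expL1 V (V.proj k v)

/-- `l`-component of `n - 1/T` when `n = l + i/T`. -/
def predL (l i : ℕ) : ℕ := if i = 0 then l - 1 else l

/-- `i`-component of `n - 1/T` when `n = l + i/T`. -/
def predI (T i : ℕ) : ℕ := if i = 0 then T - 1 else i - 1

/-- The rational number `n = l + i/T`. -/
def nval (T l i : ℕ) : ℚ := (l : ℚ) + (i : ℚ) / (T : ℚ)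

/-- A weak `g`-twisted `V`-module: modes `v_m = act v m` for `m ∈ (1/T)ℤ ⊆ ℚ`,
satisfying the truncation, vacuum and twisted Borcherds (Jacobi) identities. -/
structure TwModule (V : VOA) (g : VOAAut V) (T : ℕ) where
  carrier : Type
  [acg : AddCommGroup carrier]
  [mod : Module ℂ carrier]
  act : V.carrier →ₗ[ℂ] (ℚ → carrier →ₗ[ℂ] carrier)
  act_eig : ∀ r : ℕ, r < T → ∀ u ∈ eigSpace V g T r, ∀ m : ℚ,
    (¬ ∃ z : ℤ, m = (z : ℚ) + (r : ℚ) / (T : ℚ)) → act u m = 0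
  act_trunc : ∀ (u : V.carrier) (x : carrier), ∃ N : ℤ, ∀ m : ℚ, (N : ℚ) ≤ m → act u m x = 0
  act_vacuum : ∀ (m : ℚ) (x : carrier), act V.vacuum m x = if m = -1 then x else 0
  jacobi : ∀ r s : ℕ, r < T → s < T → ∀ u ∈ eigSpace V g T r, ∀ v ∈ eigSpace V g T s,
    ∀ (a b c : ℤ) (x : carrier),
    ∑ᶠ j : ℕ, ((qchoose ((r : ℚ) / (T : ℚ) + (a : ℚ)) j : ℚ) : ℂ) •
        act (V.mode u (c + j) v) ((r : ℚ) / (T : ℚ) + (s : ℚ) / (T : ℚ) + a + b - j) x =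
    ∑ᶠ j : ℕ, ((-1 : ℂ) ^ j * ((qchoose (c : ℚ) j : ℚ) : ℂ)) •
        (act u ((r : ℚ) / (T : ℚ) + a + c - j) (act v ((s : ℚ) / (T : ℚ) + b + j) x)
          - ((-1 : ℂ) ^ c) •
            act v ((s : ℚ) / (T : ℚ) + b + c - j) (act u ((r : ℚ) / (T : ℚ) + a + j) x))

attribute [instance] TwModule.acg TwModule.mod

namespace TwModule

variable {V : VOA} {g : VOAAut V} {T : ℕ}

/-- The operator `o_p(a) = a_{wt a - 1 - p}`, extended linearly from homogeneous `a`. -/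
def oactL (M : TwModule V g T) (p : ℚ) (a : V.carrier) : M.carrier →ₗ[ℂ] M.carrier :=
  ∑ᶠ k : ℤ, M.act (V.proj k a) ((k : ℚ) - 1 - p)

/-- `Ω_n(M) = {x ∈ M | V[g]_{-k} x = 0 for all k > n}`, i.e. `v_m x = 0` whenever
`v` is homogeneous of weight `d` and `d - 1 - m < -n`. -/
def Omega (M : TwModule V g T) (n : ℚ) : Submodule ℂ M.carrier where
  carrier := {x | ∀ (k : ℤ) (u : V.carrier), u ∈ V.wtSpace k → ∀ m : ℚ,
    (k : ℚ) - 1 + n < m → M.act u m x = 0}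
  add_mem' := fun {a b} ha hb => by
    intro k u hu m hm
    rw [map_add, ha k u hu m hm, hb k u hu m hm, add_zero]
  zero_mem' := fun k u hu m hm => map_zero _
  smul_mem' := fun c a ha => by
    intro k u hu m hm
    rw [map_smul, ha k u hu m hm, smul_zero]

theorem mem_Omega {M : TwModule V g T} {n : ℚ} {x : M.carrier} :
    x ∈ M.Omega n ↔ ∀ (k : ℤ) (u : V.carrier), u ∈ V.wtSpace k → ∀ m : ℚ,
      (k : ℚ) - 1 + n < m → M.act u m x = 0 := Iff.rfl

/-- `Ω_{n-1/T}(M)`, viewed as a submodule of `Ω_n(M)`. -/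
def OmegaSub (M : TwModule V g T) (n : ℚ) : Submodule ℂ (M.Omega n) :=
  (M.Omega (n - 1 / (T : ℚ))).comap (M.Omega n).subtype

/-- The quotient `Ω_n(M)/Ω_{n-1/T}(M)`. -/
abbrev OmegaQ (M : TwModule V g T) (n : ℚ) :=
  (M.Omega n) ⧸ (M.OmegaSub n)

open Classical in
/-- The action of `o(a)` on `Ω_n(M)` (it does preserve `Ω_n(M)`). -/
def oactOmega (M : TwModule V g T) (n : ℚ) (a : V.carrier) :
    M.Omega n →ₗ[ℂ] M.Omega n :=
  if h : ∀ x ∈ M.Omega n, M.oactL 0 a x ∈ M.Omega n then (M.oactL 0 a).restrict h else 0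

open Classical in
/-- The induced action of `o(a)` on `Ω_n(M)/Ω_{n-1/T}(M)`. -/
def oactQ (M : TwModule V g T) (n : ℚ) (a : V.carrier) :
    M.OmegaQ n →ₗ[ℂ] M.OmegaQ n :=
  if h : M.OmegaSub n ≤ (M.OmegaSub n).comap (M.oactOmega n a) then
    Submodule.mapQ _ _ (M.oactOmega n a) h
  else 0

end TwModule

/-- A morphism of weak `g`-twisted `V`-modules. -/
structure TwHom {V : VOA} {g : VOAAut V} {T : ℕ} (M N : TwModule V g T) where
  toLin : M.carrier →ₗ[ℂ] N.carrier
  comm : ∀ (u : V.carrier) (m : ℚ) (x : M.carrier), toLin (M.act u m x) = N.act u m (toLin x)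

namespace TwHom

variable {V : VOA} {g : VOAAut V} {T : ℕ}

def id (M : TwModule V g T) : TwHom M M := ⟨LinearMap.id, fun _ _ _ => rfl⟩

def comp {M N P : TwModule V g T} (f' : TwHom N P) (f : TwHom M N) : TwHom M P :=
  ⟨f'.toLin.comp f.toLin, fun u m x => by
    simp only [LinearMap.comp_apply, f.comm, f'.comm]⟩

theorem mapsOmega {M N : TwModule V g T} (f : TwHom M N) (n : ℚ) :
    ∀ x ∈ M.Omega n, f.toLin x ∈ N.Omega n := fun x hx k u hu m hm => by
  rw [← f.comm, hx k u hu m hm, map_zero]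

/-- The restriction of a morphism to `Ω_n`. -/
def omegaMap {M N : TwModule V g T} (f : TwHom M N) (n : ℚ) :
    M.Omega n →ₗ[ℂ] N.Omega n :=
  f.toLin.restrict (f.mapsOmega n)

/-- The induced map `Ω_n(M)/Ω_{n-1/T}(M) → Ω_n(N)/Ω_{n-1/T}(N)`. -/
def omegaQMap {M N : TwModule V g T} (f : TwHom M N) (n : ℚ) :
    M.OmegaQ n →ₗ[ℂ] N.OmegaQ n :=
  Submodule.mapQ _ _ (f.omegaMap n) (fun x hx => f.mapsOmega (n - 1 / (T : ℚ)) x.1 hx)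

end TwHom

/-- An admissible (`(1/T)ℤ≥0`-graded) `g`-twisted `V`-module. -/
structure AdmTwModule (V : VOA) (g : VOAAut V) (T : ℕ) extends TwModule V g T where
  grade : ℚ → Submodule ℂ carrier
  [gdecomp : DirectSum.Decomposition grade]
  grade_support : ∀ q : ℚ, (q < 0 ∨ ¬ ∃ z : ℤ, q = (z : ℚ) / (T : ℚ)) → grade q = ⊥
  grade_act : ∀ (k : ℤ) (u : V.carrier), u ∈ V.wtSpace k → ∀ (m p : ℚ), ∀ x ∈ grade p,
    act u m x ∈ grade (p + (k : ℚ) - m - 1)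

attribute [instance] AdmTwModule.gdecomp

namespace AdmTwModule

variable {V : VOA} {g : VOAAut V} {T : ℕ}

/-- A submodule invariant under all twisted vertex operators. -/
def InvSub (M : AdmTwModule V g T) (W : Submodule ℂ M.carrier) : Prop :=
  ∀ (u : V.carrier) (m : ℚ), ∀ x ∈ W, M.act u m x ∈ W

/-- A graded submodule (closed under homogeneous components). -/
def GradedSub (M : AdmTwModule V g T) (W : Submodule ℂ M.carrier) : Prop :=
  ∀ x ∈ W, ∀ q : ℚ, (((DirectSum.decompose M.grade x) q : M.grade q) : M.carrier) ∈ W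

/-- A simple (irreducible) admissible module: nonzero, with no proper nonzero
graded submodule. -/
def IsSimple (M : AdmTwModule V g T) : Prop :=
  (∃ x : M.carrier, x ≠ 0) ∧
  ∀ W : Submodule ℂ M.carrier, M.InvSub W → M.GradedSub W → W = ⊥ ∨ W = ⊤

/-- `W` is a simple (irreducible) admissible submodule of `M`. -/
def SubSimple (M : AdmTwModule V g T) (W : Submodule ℂ M.carrier) : Prop :=
  W ≠ ⊥ ∧ ∀ W' : Submodule ℂ M.carrier, W' ≤ W → M.InvSub W' → M.GradedSub W' →
    W' = ⊥ ∨ W' = W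

/-- `M` is a direct sum of irreducible admissible submodules. -/
def CompletelyReducible (M : AdmTwModule V g T) : Prop :=
  ∃ (κ : Type) (S : κ → Submodule ℂ M.carrier),
    (∀ j, M.InvSub (S j) ∧ M.GradedSub (S j) ∧ M.SubSimple (S j)) ∧
    iSupIndep S ∧ (⨆ j, S j) = ⊤

end AdmTwModule

/-- `V` is `g`-rational: every admissible `g`-twisted module is a direct sum of
irreducible admissible `g`-twisted modules. -/
def GRational (V : VOA) (g : VOAAut V) (T : ℕ) : Prop :=
  ∀ M : AdmTwModule V g T, M.CompletelyReducible

/-- An ordinary `g`-twisted `V`-module: graded by `L(0)`-eigenvalues with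
finite dimensional pieces and spectrum bounded below in each congruence class
mod `(1/T)ℤ`. -/
structure OrdTwModule (V : VOA) (g : VOAAut V) (T : ℕ) extends TwModule V g T where
  egrade : ℂ → Submodule ℂ carrier
  [edecomp : DirectSum.Decomposition egrade]
  egrade_L0 : ∀ lam : ℂ, ∀ x ∈ egrade lam, act V.conformal 1 x = lam • x
  egrade_findim : ∀ lam : ℂ, FiniteDimensional ℂ (egrade lam)
  egrade_bounded : ∀ lam : ℂ, ∃ N : ℤ, ∀ m : ℤ, m ≤ N →
    egrade (lam + (m : ℂ) / (T : ℂ)) = ⊥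

attribute [instance] OrdTwModule.edecomp

/-- A module over the associative algebra `A_{g,n}(V)` (with `n = l + i/T`),
given as a representation of `V` that kills `O_{g,n}(V)`, takes the vacuum to
the identity, and turns `*_{g,n}` into composition. -/
structure AMod (V : VOA) (g : VOAAut V) (T l i : ℕ) where
  carrier : Type
  [acg : AddCommGroup carrier]
  [mod : Module ℂ carrier]
  rho : V.carrier →ₗ[ℂ] (carrier →ₗ[ℂ] carrier)
  rho_O : ∀ a ∈ Ogn V g T l i, rho a = 0
  rho_one : rho V.vacuum = LinearMap.id
  rho_star : ∀ a b : V.carrier, rho (starMul V g T l a b) = (rho a).comp (rho b)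

attribute [instance] AMod.acg AMod.mod

namespace AMod

variable {V : VOA} {g : VOAAut V} {T l i : ℕ}

/-- `U` does not factor through `A_{g,n-1/T}(V)`. -/
def NotFactor (U : AMod V g T l i) : Prop :=
  ∃ a ∈ Ogn V g T (predL l i) (predI T i), U.rho a ≠ 0

/-- An invariant subspace. -/
def SubInv (U : AMod V g T l i) (W : Submodule ℂ U.carrier) : Prop :=
  ∀ a : V.carrier, ∀ x ∈ W, U.rho a x ∈ W

/-- `W` is a simple `A_{g,n}(V)`-submodule of `U`. -/
def SubSimple (U : AMod V g T l i) (W : Submodule ℂ U.carrier) : Prop :=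
  W ≠ ⊥ ∧ ∀ W' : Submodule ℂ U.carrier, W' ≤ W → U.SubInv W' → W' = ⊥ ∨ W' = W

/-- `U` is a simple `A_{g,n}(V)`-module. -/
def IsSimple (U : AMod V g T l i) : Prop :=
  (∃ x : U.carrier, x ≠ 0) ∧ ∀ W : Submodule ℂ U.carrier, U.SubInv W → W = ⊥ ∨ W = ⊤

/-- `U` is a direct sum of simple `A_{g,n}(V)`-modules. -/
def CompletelyReducible (U : AMod V g T l i) : Prop :=
  ∃ (κ : Type) (S : κ → Submodule ℂ U.carrier),
    (∀ j, U.SubInv (S j) ∧ U.SubSimple (S j)) ∧ iSupIndep S ∧ (⨆ j, S j) = ⊤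

/-- All irreducible components of `U` do not factor through `A_{g,n-1/T}(V)`. -/
def GoodComponents (U : AMod V g T l i) : Prop :=
  ∀ W : Submodule ℂ U.carrier, U.SubInv W → U.SubSimple W →
    ∃ a ∈ Ogn V g T (predL l i) (predI T i), ∃ x ∈ W, U.rho a x ≠ 0

end AMod

/-- A morphism of `A_{g,n}(V)`-modules. -/
structure AModHom {V : VOA} {g : VOAAut V} {T l i : ℕ} (U U' : AMod V g T l i) where
  toLin : U.carrier →ₗ[ℂ] U'.carrier
  comm : ∀ (a : V.carrier) (x : U.carrier), toLin (U.rho a x) = U'.rho a (toLin x)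

namespace AModHom

variable {V : VOA} {g : VOAAut V} {T l i : ℕ}

def id (U : AMod V g T l i) : AModHom U U := ⟨LinearMap.id, fun _ _ => rfl⟩

def comp {U U' U'' : AMod V g T l i} (f' : AModHom U' U'') (f : AModHom U U') :
    AModHom U U'' :=
  ⟨f'.toLin.comp f.toLin, fun a x => by simp only [LinearMap.comp_apply, f.comm, f'.comm]⟩

end AModHom

end DLM

namespace DLM

section qchoose

@[simp] theorem qchoose_zero_right (α : ℚ) : qchoose α 0 = 1 := by simp [qchoose]

@[simp] theorem qchoose_one_right (α : ℚ) : qchoose α 1 = α := by simp [qchoose]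

theorem qchoose_natCast_of_lt {n j : ℕ} (h : n < j) : qchoose (n : ℚ) j = 0 := by
  rw [qchoose, Finset.prod_eq_zero (Finset.mem_range.2 h) (sub_self _), zero_div]

end qchoose

section Dixmier

open Polynomial in
/-- On a nonzero complex vector space of countable dimension, every endomorphism
has nonempty spectrum. -/
theorem exists_not_isUnit_sub_algebraMap {K : Type*} [AddCommGroup K] [Module ℂ K]
    (hK : Module.rank ℂ K ≤ Cardinal.aleph0) (f : Module.End ℂ K) {w : K} (hw : w ≠ 0) :
    ∃ c : ℂ, ¬ IsUnit (f - algebraMap ℂ (Module.End ℂ K) c) := by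
  by_contra! hall
  have hunit : ∀ P : ℂ[X], P ≠ 0 → IsUnit (aeval f P) := by
    intro P hP
    have hprod : IsUnit (aeval f (P.roots.map (fun x => X - C x)).prod) := by
      by_contra hcon
      obtain ⟨k, hk, -⟩ := spectrum.exists_mem_of_not_isUnit_aeval_prod hcon
      have := hall k
      rw [← IsUnit.neg_iff, neg_sub] at this
      exact hk this
    rw [← IsAlgClosed.splits P |>.eq_prod_roots.symm, map_mul, aeval_C]
    exact ((IsUnit.mk0 _ (leadingCoeff_ne_zero.2 hP)).map _).mul hprod
  have hsurj : ∀ c : ℂ, ∃ x : K, (f - algebraMap ℂ (Module.End ℂ K) c) x = w := fun c =>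
    ((Module.End.isUnit_iff _).1 (hall c)).2 w
  choose x hx using hsurj
  have hli : LinearIndependent ℂ x := by
    rw [linearIndependent_iff']
    intro s a hsum i hi
    set P : ℂ[X] := ∑ j ∈ s, C (a j) * ∏ k ∈ s.erase j, (X - C k) with hPdef
    have hPw : aeval f P w = 0 := by
      calc aeval f P w
          = ∑ j ∈ s, a j • aeval f (∏ k ∈ s.erase j, (X - C k)) w := by
            simp [hPdef, map_sum, LinearMap.sum_apply]
        _ = ∑ j ∈ s, a j • aeval f (∏ k ∈ s, (X - C k)) (x j) := by
            refine Finset.sum_congr rfl fun j hj => ?_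
            rw [← Finset.prod_erase_mul s _ hj, map_mul, Module.End.mul_apply, map_sub, aeval_X,
              aeval_C, hx]
        _ = aeval f (∏ k ∈ s, (X - C k)) (∑ j ∈ s, a j • x j) := by simp [map_sum]
        _ = 0 := by rw [hsum, map_zero]
    have hP0 : P = 0 := by
      by_contra hP
      exact hw (((Module.End.isUnit_iff _).1 (hunit P hP)).1 (hPw.trans (map_zero _).symm))
    have heval : eval i P = a i * ∏ k ∈ s.erase i, (i - k) := by
      rw [hPdef, eval_finsetSum, Finset.sum_eq_single i]
      · simp [eval_prod]
      · intro j _ hji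
        rw [eval_mul, eval_prod, Finset.prod_eq_zero (Finset.mem_erase.2 ⟨hji.symm, hi⟩) (by simp),
          mul_zero]
      · exact fun h => absurd hi h
    rw [hP0, eval_zero] at heval
    refine (mul_eq_zero.1 heval.symm).resolve_right (Finset.prod_ne_zero_iff.2 fun k hk => ?_)
    exact sub_ne_zero.2 (Finset.ne_of_mem_erase hk).symm
  have hcard := hli.cardinal_lift_le_rank
  have : Cardinal.aleph0 < Cardinal.lift.{_, 0} (Cardinal.mk ℂ) := by
    rw [Cardinal.mk_complex]; simpa using Cardinal.aleph0_lt_continuum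
  exact absurd (hcard.trans (Cardinal.lift_le.2 hK)) (by simpa using this)

end Dixmier

namespace VOA

theorem proj_mem (V : VOA) (k : ℤ) (u : V.carrier) : V.proj k u ∈ V.wtSpace k :=
  SetLike.coe_mem _

theorem proj_of_mem_same {V : VOA} {k : ℤ} {u : V.carrier} (hu : u ∈ V.wtSpace k) :
    V.proj k u = u :=
  DirectSum.decompose_of_mem_same _ hu

theorem proj_of_mem_ne {V : VOA} {k j : ℤ} {u : V.carrier} (hu : u ∈ V.wtSpace k) (h : k ≠ j) :
    V.proj j u = 0 :=
  DirectSum.decompose_of_mem_ne _ hu h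

theorem iSup_wtSpace (V : VOA) : ⨆ k, V.wtSpace k = ⊤ :=
  (DirectSum.Decomposition.isInternal V.wtSpace).submodule_iSup_eq_top

theorem exists_countable_span_eq_top (V : VOA) :
    ∃ S : Set V.carrier, S.Countable ∧ Submodule.span ℂ S = ⊤ := by
  have h : ∀ k, ∃ s : Finset V.carrier, Submodule.span ℂ (s : Set V.carrier) = V.wtSpace k :=
    fun k => (Submodule.fg_iff_finiteDimensional _).2 (V.findim k)
  choose s hs using h
  refine ⟨⋃ k, (s k : Set V.carrier), Set.countable_iUnion fun k => (s k).countable_toSet, ?_⟩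
  rw [Submodule.span_iUnion, ← V.iSup_wtSpace]
  exact iSup_congr hs

theorem conformal_zero_eq (V : VOA) (u : V.carrier) :
    V.mode V.conformal 0 u = V.mode u (-2) V.vacuum := by
  have h := congrArg (fun f => f V.vacuum) (V.Lneg1_mode u (-1))
  simpa [V.creation₁] using h

end VOA

section Eigenspaces

variable {V : VOA} {g : VOAAut V} {T : ℕ}

theorem mem_eigSpace {r : ℕ} {v : V.carrier} : v ∈ eigSpace V g T r ↔ g.lin v =
    Complex.exp (-(2 * (Real.pi : ℂ) * Complex.I * (r : ℂ)) / (T : ℂ)) • v := Iff.rfl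

theorem vacuum_mem_eigSpace : V.vacuum ∈ eigSpace V g T 0 := by
  simp [mem_eigSpace, g.map_vacuum]

theorem conformal_mem_eigSpace : V.conformal ∈ eigSpace V g T 0 := by
  simp [mem_eigSpace, g.map_conformal]

theorem VOAAut.pow_mem_wtSpace (g : VOAAut V) {k : ℤ} {u : V.carrier} (hu : u ∈ V.wtSpace k)
    (t : ℕ) : (g.lin ^ t) u ∈ V.wtSpace k := by
  induction t with
  | zero => simpa using hu
  | succ t ih =>
    rw [pow_succ', LinearEquiv.mul_apply]
    exact (g.map_wt k _).1 ih

theorem eigProj_mem_wtSpace {k : ℤ} {u : V.carrier} (hu : u ∈ V.wtSpace k) (r : ℕ) :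
    eigProj V g T r u ∈ V.wtSpace k :=
  Submodule.smul_mem _ _ <| Submodule.sum_mem _ fun t _ =>
    Submodule.smul_mem _ _ (g.pow_mem_wtSpace hu t)

theorem eigProj_mem_eigSpace (hT : 0 < T) (hg : g.lin ^ T = 1) (r : ℕ) (u : V.carrier) :
    eigProj V g T r u ∈ eigSpace V g T r := by
  have hT' : (T : ℂ) ≠ 0 := by exact_mod_cast hT.ne'
  rw [mem_eigSpace, eigProj, map_smul, smul_comm]
  congr 1
  rw [map_sum, Finset.smul_sum]
  set F : ℕ → V.carrier := fun t =>
    Complex.exp (-(2 * (Real.pi : ℂ) * Complex.I * (r : ℂ)) / (T : ℂ)) •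
      Complex.exp ((2 * (Real.pi : ℂ) * Complex.I * (r : ℂ) * (t : ℂ)) / (T : ℂ)) •
      ((g.lin ^ t) u) with hF
  have hstep : ∀ t : ℕ, g.lin (Complex.exp ((2 * (Real.pi : ℂ) * Complex.I * (r : ℂ) * (t : ℂ)) /
      (T : ℂ)) • ((g.lin ^ t) u)) = F (t + 1) := by
    intro t
    simp only [hF]
    rw [map_smul, smul_smul, ← Complex.exp_add, pow_succ', LinearEquiv.mul_apply]
    congr 2
    push_cast
    field_simp
    ring
  have hper : F T = F 0 := by
    simp only [hF, hg]
    congr 1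
    have : Complex.exp (2 * (Real.pi : ℂ) * Complex.I * (r : ℂ) * (T : ℂ) / (T : ℂ)) = 1 := by
      rw [mul_div_cancel_right₀ _ hT', mul_comm, Complex.exp_nat_mul_two_pi_mul_I]
    rw [this]
    simp
  rw [Finset.sum_congr rfl fun t _ => hstep t]
  have h1 := Finset.sum_range_succ F T
  rw [Finset.sum_range_succ' F T, hper] at h1
  exact add_right_cancel h1

theorem sum_eigProj (hT : 0 < T) (u : V.carrier) :
    ∑ r ∈ Finset.range T, eigProj V g T r u = u := by
  have hT' : (T : ℂ) ≠ 0 := by exact_mod_cast hT.ne'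
  have hζ := Complex.isPrimitiveRoot_exp T hT.ne'
  have hexp : ∀ r t : ℕ, Complex.exp ((2 * (Real.pi : ℂ) * Complex.I * (r : ℂ) * (t : ℂ)) /
      (T : ℂ)) = (Complex.exp (2 * (Real.pi : ℂ) * Complex.I / (T : ℂ)) ^ t) ^ r := by
    intro r t
    rw [← pow_mul, ← Complex.exp_nat_mul]
    congr 1
    push_cast
    ring
  simp only [eigProj, ← Finset.smul_sum]
  rw [Finset.sum_comm]
  simp only [← Finset.sum_smul, hexp]
  rw [Finset.sum_eq_single 0]
  · simp [smul_smul, hT']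
  · intro t ht ht0
    rw [geom_sum_eq, pow_right_comm, hζ.pow_eq_one, one_pow, sub_self, zero_div, zero_smul]
    exact hζ.pow_ne_one_of_pos_of_lt ht0 (Finset.mem_range.1 ht)
  · exact fun h => absurd (Finset.mem_range.2 hT) h

/-- To prove an additive statement for a homogeneous vector, it is enough to treat
homogeneous eigenvectors of `g`. -/
theorem wtSpace_eig_induction (hT : 0 < T) (hg : g.lin ^ T = 1) {k : ℤ} {P : V.carrier → Prop}
    (hzero : P 0) (hadd : ∀ u v, P u → P v → P (u + v))
    (heig : ∀ r < T, ∀ u ∈ eigSpace V g T r, u ∈ V.wtSpace k → P u)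
    {u : V.carrier} (hu : u ∈ V.wtSpace k) : P u := by
  rw [← sum_eigProj (g := g) hT u]
  exact Finset.sum_induction _ P hadd hzero fun r hr =>
    heig r (Finset.mem_range.1 hr) _ (eigProj_mem_eigSpace hT hg r u) (eigProj_mem_wtSpace hu r)

/-- To prove an additive statement for a vector, it is enough to treat
eigenvectors of `g`. -/
theorem eig_induction (hT : 0 < T) (hg : g.lin ^ T = 1) {P : V.carrier → Prop}
    (hzero : P 0) (hadd : ∀ u v, P u → P v → P (u + v))
    (heig : ∀ r < T, ∀ u ∈ eigSpace V g T r, P u) (u : V.carrier) : P u := by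
  rw [← sum_eigProj (g := g) hT u]
  exact Finset.sum_induction _ P hadd hzero fun r hr =>
    heig r (Finset.mem_range.1 hr) _ (eigProj_mem_eigSpace hT hg r u)

end Eigenspaces

namespace TwModule

variable {V : VOA} {g : VOAAut V} {T : ℕ} (M : TwModule V g T)

theorem oactL_of_mem {k : ℤ} {a : V.carrier} (ha : a ∈ V.wtSpace k) (p : ℚ) :
    M.oactL p a = M.act a ((k : ℚ) - 1 - p) := by
  rw [oactL, finsum_eq_single _ k, VOA.proj_of_mem_same ha]
  intro j hj
  rw [VOA.proj_of_mem_ne ha hj.symm, map_zero, Pi.zero_apply]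

theorem oactL_conformal : M.oactL 0 V.conformal = M.act V.conformal 1 := by
  rw [M.oactL_of_mem V.conformal_wt]
  norm_num

/-- The `L(-1)`-derivative property, for eigenvectors of `g`. -/
theorem act_conformal_zero (hT : 0 < T) {r : ℕ} (hr : r < T) {u : V.carrier}
    (hu : u ∈ eigSpace V g T r) (m : ℤ) (x : M.carrier) :
    M.act (V.mode V.conformal 0 u) ((r : ℚ) / T + m) x =
      -((((r : ℚ) / T + m : ℚ)) : ℂ) • M.act u ((r : ℚ) / T + m - 1) x := by
  have hj := M.jacobi r 0 hr hT u hu V.vacuum vacuum_mem_eigSpace (m + 1) (-1) (-2) x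
  have hvac : ∀ (c : ℚ) (y : M.carrier), c ≠ -1 → M.act V.vacuum c y = 0 := fun c y hc => by
    rw [M.act_vacuum, if_neg hc]
  rw [finsum_eq_sum_of_support_subset (s := Finset.range 2),
    finsum_eq_single _ 0] at hj
  · rw [Finset.sum_range_succ, Finset.sum_range_one, hvac (_ - _)] at hj
    · simp only [qchoose_zero_right, qchoose_one_right, M.act_vacuum] at hj
      rw [V.conformal_zero_eq]
      norm_num [V.creation₁] at hj
      have e₁ : (r : ℚ) / T + (m + 1) + -1 = r / T + m := by ring
      have e₂ : (r : ℚ) / T + (m + 1) + -2 = r / T + m - 1 := by ring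
      rw [e₁, e₂] at hj
      rw [eq_sub_of_add_eq hj]
      push_cast
      module
    · norm_num
  · intro j hj0
    have hpos : (0 : ℚ) < j := by exact_mod_cast Nat.pos_of_ne_zero hj0
    rw [hvac, hvac]
    · simp
    · push_cast
      intro h
      rw [zero_div] at h
      linarith
    · push_cast
      intro h
      rw [zero_div] at h
      linarith
  · intro j hj0
    by_contra hlt
    refine hj0 ?_
    rw [Finset.coe_range, Set.mem_Iio] at hlt
    simp only
    rw [V.creation₂ _ _ (by omega)]
    simp

/-- The operator `L(0)` shifts degrees: `[L(0), u_m] = (wt u - m - 1) u_m`. -/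
theorem act_conformal_act (hT : 0 < T) (hg : g.lin ^ T = 1) {k : ℤ} {u : V.carrier}
    (hu : u ∈ V.wtSpace k) (m : ℚ) (x : M.carrier) :
    M.act V.conformal 1 (M.act u m x) =
      M.act u m (M.act V.conformal 1 x) + (((k : ℚ) - m - 1 : ℚ) : ℂ) • M.act u m x := by
  revert m x
  refine wtSpace_eig_induction (g := g) hT hg (P := fun u => ∀ (m : ℚ) (x : M.carrier),
    M.act V.conformal 1 (M.act u m x) =
      M.act u m (M.act V.conformal 1 x) + (((k : ℚ) - m - 1 : ℚ) : ℂ) • M.act u m x)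
    ?_ ?_ ?_ hu
  · simp
  · intro u v hu hv m x
    simp only [map_add, Pi.add_apply, LinearMap.add_apply, hu, hv, smul_add]
    abel
  intro r hr u hu hk m x
  by_cases hm : ∃ z : ℤ, m = (z : ℚ) + (r : ℚ) / (T : ℚ)
  swap
  · simp [M.act_eig r hr u hu m hm]
  obtain ⟨z, rfl⟩ := hm
  have hj := M.jacobi 0 r hT hr V.conformal conformal_mem_eigSpace u hu 1 z 0 x
  rw [finsum_eq_sum_of_support_subset (s := Finset.range 2),
    finsum_eq_single _ 0] at hj
  · rw [Finset.sum_range_succ, Finset.sum_range_one] at hj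
    have hd := M.act_conformal_zero hT hr hu (z + 1) x
    simp only [qchoose_zero_right, qchoose_one_right] at hj
    norm_num [V.L0_grading k u hk] at hj
    have e₁ : (r : ℚ) / T + 1 + z = r / T + (z + 1 : ℤ) := by push_cast; ring
    have e₂ : (r : ℚ) / T + (z + 1 : ℤ) - 1 = z + r / T := by push_cast; ring
    have e₃ : (r : ℚ) / T + z = z + r / T := by ring
    rw [e₁, hd, e₂] at hj
    rw [e₃] at hj
    rw [← sub_eq_iff_eq_add', ← hj]
    push_cast
    module
  · intro j hj0
    have h := qchoose_natCast_of_lt (Nat.pos_of_ne_zero hj0)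
    rw [Nat.cast_zero] at h
    simp [h]
  · intro j hj0
    by_contra hlt
    refine hj0 ?_
    rw [Finset.coe_range, Set.mem_Iio, not_lt] at hlt
    have h := qchoose_natCast_of_lt (n := 1) (j := j) (by omega)
    rw [Nat.cast_one] at h
    simp [h]

/-- Associativity: a product of two modes applied to `x` is a combination of
single modes applied to `x`. -/
theorem act_act_mem_span (hT : 0 < T) (hg : g.lin ^ T = 1) (u v : V.carrier) (m n : ℚ)
    (x : M.carrier) (N : Submodule ℂ M.carrier)
    (hN : ∀ (w : V.carrier) (c : ℚ), M.act w c x ∈ N) :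
    M.act u m (M.act v n x) ∈ N := by
  revert m n
  refine eig_induction (g := g) hT hg
    (P := fun u => ∀ m n : ℚ, M.act u m (M.act v n x) ∈ N) (by simp) ?_ ?_ u
  · intro u u' hu hu' m n
    simpa using N.add_mem (hu m n) (hu' m n)
  intro r hr u hu
  refine eig_induction (g := g) hT hg
    (P := fun v => ∀ m n : ℚ, M.act u m (M.act v n x) ∈ N) (by simp) ?_ ?_ v
  · intro v v' hv hv' m n
    simpa using N.add_mem (hv m n) (hv' m n)
  intro s hs v hv m n
  by_cases hm : ∃ z : ℤ, m = (z : ℚ) + (r : ℚ) / (T : ℚ)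
  swap
  · simp [M.act_eig r hr u hu m hm]
  by_cases hn : ∃ z : ℤ, n = (z : ℚ) + (s : ℚ) / (T : ℚ)
  swap
  · simp [M.act_eig s hs v hv n hn]
  obtain ⟨z, rfl⟩ := hm
  obtain ⟨y, rfl⟩ := hn
  obtain ⟨A, hA⟩ := M.act_trunc u x
  obtain ⟨B, hB⟩ := M.act_trunc v x
  have key : ∀ (d : ℕ) (y z : ℤ), B - d ≤ y →
      M.act u (z + (r : ℚ) / T) (M.act v (y + (s : ℚ) / T) x) ∈ N := by
    intro d
    induction d with
    | zero =>
      intro y z hy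
      rw [hB, map_zero]
      · exact N.zero_mem
      · have : (B : ℚ) ≤ y := by exact_mod_cast (by simpa using hy : B ≤ y)
        have : (0 : ℚ) ≤ (s : ℚ) / T := by positivity
        linarith
    | succ d ih =>
      intro y z hy
      have hj := M.jacobi r s hr hs u hu v hv A y (z - A) x
      have hu0 : ∀ j : ℕ, M.act u ((r : ℚ) / T + A + j) x = 0 := fun j => hA _ <| by
        have : (0 : ℚ) ≤ (r : ℚ) / T + j := by positivity
        linarith
      have hv0 : ∀ j : ℕ, (d + 1 : ℕ) ≤ j → M.act v ((s : ℚ) / T + y + j) x = 0 :=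
        fun j hdj => hB _ <| by
          have : (0 : ℚ) ≤ (s : ℚ) / T := by positivity
          have : (B : ℚ) ≤ y + j := by exact_mod_cast (by omega : B ≤ y + j)
          linarith
      simp only [hu0, map_zero, smul_zero, sub_zero] at hj
      rw [finsum_eq_sum_of_support_subset (s := Finset.range (d + 1)) (f := fun j : ℕ =>
        ((-1 : ℂ) ^ j * ((qchoose ((z - A : ℤ) : ℚ) j : ℚ) : ℂ)) •
          M.act u ((r : ℚ) / T + A + (z - A : ℤ) - j) (M.act v ((s : ℚ) / T + y + j) x)),
        Finset.sum_range_succ'] at hj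
      · have e₁ : (r : ℚ) / T + A + (z - A : ℤ) - (0 : ℕ) = z + r / T := by push_cast; ring
        have e₂ : (s : ℚ) / T + y + (0 : ℕ) = y + s / T := by push_cast; ring
        rw [e₁, e₂, qchoose_zero_right, pow_zero, Rat.cast_one, mul_one, one_smul] at hj
        rw [← sub_eq_of_eq_add' hj]
        refine sub_mem (finsum_induction (· ∈ N) N.zero_mem (fun _ _ => N.add_mem)
          fun j => N.smul_mem _ (hN _ _)) (N.sum_mem fun j _ => N.smul_mem _ ?_)
        have h := ih (y + (j + 1 : ℕ)) (z - (j + 1 : ℕ)) (by omega)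
        convert h using 3
        · push_cast; ring
        · push_cast; ring_nf
      · intro j hj0
        by_contra hlt
        refine hj0 ?_
        rw [Finset.coe_range, Set.mem_Iio, not_lt] at hlt
        simp only
        rw [hv0 j hlt, map_zero, smul_zero]
  exact key (B - y).toNat y z (by omega)

end TwModule

namespace AdmTwModule

variable {V : VOA} {g : VOAAut V} {T : ℕ} (M : AdmTwModule V g T)

/-- The submodule spanned by all modes of homogeneous vectors applied to `W`. -/
def modeSpan (W : Submodule ℂ M.carrier) : Submodule ℂ M.carrier :=
  Submodule.span ℂ {y | ∃ (k : ℤ) (u : V.carrier) (m : ℚ) (x : M.carrier),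
    u ∈ V.wtSpace k ∧ x ∈ W ∧ y = M.act u m x}

theorem act_mem_modeSpan {W : Submodule ℂ M.carrier} {x : M.carrier} (hx : x ∈ W)
    (u : V.carrier) (m : ℚ) : M.act u m x ∈ M.modeSpan W := by
  have hu : u ∈ ⨆ k, V.wtSpace k := V.iSup_wtSpace ▸ Submodule.mem_top
  induction hu using Submodule.iSup_induction' with
  | mem k u hu => exact Submodule.subset_span ⟨k, u, m, x, hu, hx, rfl⟩
  | zero => simp
  | add u v _ _ hu hv => simpa using add_mem hu hv

theorem le_modeSpan (W : Submodule ℂ M.carrier) : W ≤ M.modeSpan W := fun x hx => by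
  simpa [M.act_vacuum] using M.act_mem_modeSpan hx V.vacuum (-1)

theorem invSub_modeSpan (hT : 0 < T) (hg : g.lin ^ T = 1) (W : Submodule ℂ M.carrier) :
    M.InvSub (M.modeSpan W) := by
  intro u m y hy
  induction hy using Submodule.span_induction with
  | mem y hy =>
    obtain ⟨k, v, n, x, -, hx, rfl⟩ := hy
    exact M.act_act_mem_span hT hg u v m n x _ fun w c => M.act_mem_modeSpan hx w c
  | zero => simp
  | add y z _ _ hy hz => simpa using add_mem hy hz
  | smul c y _ hy => simpa using Submodule.smul_mem _ c hy

/-- A linear condition on components holds on `modeSpan W` when it holds for the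
components of the generators. -/
theorem decompose_modeSpan_mem {p : ℚ} {W : Submodule ℂ M.carrier} (hW : W ≤ M.grade p)
    (q : ℚ) (N : Submodule ℂ M.carrier)
    (hN : ∀ (k : ℤ) (u : V.carrier) (m : ℚ) (x : M.carrier), u ∈ V.wtSpace k → x ∈ W →
      p + k - m - 1 = q → M.act u m x ∈ N) {y : M.carrier} (hy : y ∈ M.modeSpan W) :
    ((DirectSum.decompose M.grade y q : M.grade q) : M.carrier) ∈ N := by
  induction hy using Submodule.span_induction with
  | mem y hy =>
    obtain ⟨k, u, m, x, hu, hx, rfl⟩ := hy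
    have hmem := M.grade_act k u hu m p x (hW hx)
    by_cases hq : p + k - m - 1 = q
    · rw [hq] at hmem
      rw [DirectSum.decompose_of_mem_same _ hmem]
      exact hN k u m x hu hx hq
    · rw [DirectSum.decompose_of_mem_ne _ hmem hq]
      exact N.zero_mem
  | zero => simp
  | add y z _ _ hy hz => simpa [DirectSum.decompose_add] using add_mem hy hz
  | smul c y _ hy =>
    rw [DirectSum.decompose_smul, DirectSum.smul_apply, Submodule.coe_smul]
    exact N.smul_mem c hy

theorem gradedSub_modeSpan {p : ℚ} {W : Submodule ℂ M.carrier} (hW : W ≤ M.grade p) :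
    M.GradedSub (M.modeSpan W) := fun _ hy q =>
  M.decompose_modeSpan_mem hW q _ (fun _ _ _ _ _ hx _ => M.act_mem_modeSpan hx _ _) hy

theorem modeSpan_eq_top (hT : 0 < T) (hg : g.lin ^ T = 1) (hsimp : M.IsSimple) {p : ℚ}
    {W : Submodule ℂ M.carrier} (hW : W ≤ M.grade p) (hW0 : W ≠ ⊥) : M.modeSpan W = ⊤ :=
  (hsimp.2 _ (M.invSub_modeSpan hT hg W) (M.gradedSub_modeSpan hW)).resolve_left fun h =>
    hW0 (le_bot_iff.1 (h ▸ M.le_modeSpan W))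

theorem oactL_zero_mem_grade (a : V.carrier) {p : ℚ} {x : M.carrier} (hx : x ∈ M.grade p) :
    M.oactL 0 a x ∈ M.grade p := by
  refine finsum_induction (fun f : M.carrier →ₗ[ℂ] M.carrier => f x ∈ M.grade p)
    (zero_mem _) (fun _ _ => add_mem) fun k => ?_
  have h := M.grade_act k _ (V.proj_mem k a) ((k : ℚ) - 1 - 0) p x hx
  convert h using 2
  ring

theorem act_conformal_oactL_zero (hT : 0 < T) (hg : g.lin ^ T = 1) (a : V.carrier)
    (x : M.carrier) :
    M.act V.conformal 1 (M.oactL 0 a x) = M.oactL 0 a (M.act V.conformal 1 x) := by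
  refine finsum_induction (fun f : M.carrier →ₗ[ℂ] M.carrier =>
    M.act V.conformal 1 (f x) = f (M.act V.conformal 1 x)) (by simp)
    (fun f f' hf hf' => by simp [hf, hf']) fun k => ?_
  rw [M.act_conformal_act hT hg (V.proj_mem k a)]
  simp

/-- Each graded piece of a simple module is simple under the zero modes `o(a)`. -/
theorem eq_bot_or_eq_grade (hT : 0 < T) (hg : g.lin ^ T = 1) (hsimp : M.IsSimple) {p : ℚ}
    {W : Submodule ℂ M.carrier} (hW : W ≤ M.grade p)
    (hinv : ∀ a : V.carrier, ∀ x ∈ W, M.oactL 0 a x ∈ W) : W = ⊥ ∨ W = M.grade p := by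
  refine or_iff_not_imp_left.2 fun hW0 => le_antisymm hW fun x hx => ?_
  have hmem : x ∈ M.modeSpan W := M.modeSpan_eq_top hT hg hsimp hW hW0 ▸ Submodule.mem_top
  have h := M.decompose_modeSpan_mem hW p W (fun k u m y hu hy hq => ?_) hmem
  · rwa [DirectSum.decompose_of_mem_same _ hx] at h
  · have := hinv u y hy
    rw [M.oactL_of_mem hu] at this
    convert this using 3
    linarith

theorem rank_le_aleph0 (hT : 0 < T) (hg : g.lin ^ T = 1) (hsimp : M.IsSimple) {p : ℚ}
    (hp : M.grade p ≠ ⊥) : Module.rank ℂ M.carrier ≤ Cardinal.aleph0 := by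
  obtain ⟨w, hw, hw0⟩ := Submodule.exists_mem_ne_zero_of_ne_bot hp
  obtain ⟨S, hS, hStop⟩ := V.exists_countable_span_eq_top
  have htop : M.modeSpan (ℂ ∙ w) = ⊤ := M.modeSpan_eq_top hT hg hsimp
    ((Submodule.span_singleton_le_iff_mem _ _).2 hw) (by simpa using hw0)
  have hgen : Submodule.span ℂ
      ((fun a : ℚ × V.carrier => M.act a.2 a.1 w) '' (Set.univ ×ˢ S)) = ⊤ := by
    rw [eq_top_iff, ← htop, modeSpan, Submodule.span_le]
    rintro _ ⟨k, u, m, x, -, hx, rfl⟩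
    obtain ⟨c, rfl⟩ := Submodule.mem_span_singleton.1 hx
    rw [map_smul]
    refine Submodule.smul_mem _ c ?_
    have hu : u ∈ Submodule.span ℂ S := hStop ▸ Submodule.mem_top
    induction hu using Submodule.span_induction with
    | mem u hu => exact Submodule.subset_span ⟨(m, u), ⟨trivial, hu⟩, rfl⟩
    | zero => simp
    | add u v _ _ hu hv => simpa using add_mem hu hv
    | smul c u _ hu => simpa using Submodule.smul_mem _ c hu
  rw [← rank_top, ← hgen]
  exact (rank_span_le _).trans
    ((Set.countable_univ.prod hS).image _).le_aleph0

/-- `L(0)` acts by a scalar on each graded piece of a simple module. -/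
theorem exists_act_conformal_eq_smul (hT : 0 < T) (hg : g.lin ^ T = 1) (hsimp : M.IsSimple)
    {p : ℚ} (hp : M.grade p ≠ ⊥) :
    ∃ c : ℂ, ∀ x ∈ M.grade p, M.act V.conformal 1 x = c • x := by
  have hL : ∀ x ∈ M.grade p, M.act V.conformal 1 x ∈ M.grade p := fun x hx => by
    simpa [M.oactL_conformal] using M.oactL_zero_mem_grade V.conformal hx
  obtain ⟨w, hw, hw0⟩ := Submodule.exists_mem_ne_zero_of_ne_bot hp
  obtain ⟨c, hc⟩ := exists_not_isUnit_sub_algebraMap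
    ((Submodule.rank_le (M.grade p)).trans (M.rank_le_aleph0 hT hg hsimp hp))
    ((M.act V.conformal 1).restrict hL) (w := ⟨w, hw⟩) (by simpa [Subtype.ext_iff] using hw0)
  refine ⟨c, fun x hx => ?_⟩
  set D : M.carrier →ₗ[ℂ] M.carrier := M.act V.conformal 1 - c • LinearMap.id with hD
  have hDcomm : ∀ a x, D (M.oactL 0 a x) = M.oactL 0 a (D x) := fun a x => by
    simp [hD, M.act_conformal_oactL_zero hT hg]
  have hDmem : ∀ x ∈ M.grade p, D x ∈ M.grade p := fun x hx => by
    simpa [hD] using sub_mem (hL x hx) (Submodule.smul_mem _ c hx)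
  suffices h : D x = 0 by simpa [hD, sub_eq_zero] using h
  rcases M.eq_bot_or_eq_grade hT hg hsimp (W := M.grade p ⊓ LinearMap.ker D) inf_le_left
    (fun a y hy => ⟨M.oactL_zero_mem_grade a hy.1, by
      have := hy.2
      simp only [SetLike.mem_coe, LinearMap.mem_ker] at this ⊢
      rw [hDcomm, this, map_zero]⟩) with hker | hker
  swap
  · exact (hker.symm ▸ hx : x ∈ M.grade p ⊓ LinearMap.ker D).2
  rcases M.eq_bot_or_eq_grade hT hg hsimp (W := (M.grade p).map D)
    (Submodule.map_le_iff_le_comap.2 hDmem)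
    (fun a y hy => by
      obtain ⟨z, hz, rfl⟩ := hy
      exact ⟨_, M.oactL_zero_mem_grade a hz, hDcomm a z⟩) with hran | hran
  · simpa [hran] using Submodule.mem_map_of_mem (f := D) hx
  refine absurd ((Module.End.isUnit_iff _).2 ⟨?_, ?_⟩) hc
  · rw [← LinearMap.ker_eq_bot, LinearMap.ker_eq_bot']
    intro y hy
    have : (y : M.carrier) ∈ M.grade p ⊓ LinearMap.ker D :=
      ⟨y.2, by simpa [hD, Subtype.ext_iff] using hy⟩
    rw [hker] at this
    simpa using this
  · intro y
    obtain ⟨z, hz, hzy⟩ := (hran.symm ▸ y.2 : (y : M.carrier) ∈ (M.grade p).map D)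
    exact ⟨⟨z, hz⟩, Subtype.ext (by simpa [hD] using hzy)⟩

/-- If `L(0)` acts as `c` on a nonzero graded piece `M(p)` of a simple module, then it acts as
`c + q - p` on `M(q)`. -/
theorem act_conformal_eq_smul_of_eq_smul (hT : 0 < T) (hg : g.lin ^ T = 1) (hsimp : M.IsSimple)
    {p : ℚ} (hp : M.grade p ≠ ⊥) {c : ℂ}
    (hc : ∀ x ∈ M.grade p, M.act V.conformal 1 x = c • x) {q : ℚ} {y : M.carrier}
    (hy : y ∈ M.grade q) : M.act V.conformal 1 y = (c + ((q - p : ℚ) : ℂ)) • y := by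
  have hmem : y ∈ M.modeSpan (M.grade p) :=
    M.modeSpan_eq_top hT hg hsimp le_rfl hp ▸ Submodule.mem_top
  have h := M.decompose_modeSpan_mem le_rfl q
    (LinearMap.ker (M.act V.conformal 1 - (c + ((q - p : ℚ) : ℂ)) • LinearMap.id))
    (fun k u m x hu hx hq => ?_) hmem
  · rw [DirectSum.decompose_of_mem_same _ hy] at h
    simpa [sub_eq_zero] using h
  · have hq' : (k : ℚ) - m - 1 = q - p := by linarith
    simp [M.act_conformal_act hT hg hu, hc x hx, hq', add_smul]

end AdmTwModule

end DLM

namespace DLM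

/-- **Proposition 3.4 (iii).** Let `M = ⊕_{m ≥ 0} M(m)` be a simple admissible
`g`-twisted `V`-module with `M(0) ≠ 0`.  Then each (nonzero) `M(p)` with
`0 ≤ p ≤ n` is a simple `A_{g,n}(V)`-module via `a ↦ o(a) = a_{wt a - 1}`, and
distinct nonzero `M(p)`, `M(q)` are inequivalent `A_{g,n}(V)`-modules. -/
theorem grades_simple_A_modules (V : VOA) (g : VOAAut V) (T : ℕ) (hT : 0 < T)
    (hg : g.lin ^ T = 1) (l i : ℕ) (hi : i ≤ T - 1)
    (M : AdmTwModule V g T) (hsimp : M.IsSimple) (h0 : M.grade 0 ≠ ⊥) :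
    (∀ p : ℚ, 0 ≤ p → p ≤ nval T l i →
      (∀ a : V.carrier, ∀ x ∈ M.grade p,
        M.toTwModule.oactL 0 a x ∈ M.grade p) ∧
      (M.grade p ≠ ⊥ → ∀ W : Submodule ℂ M.carrier, W ≤ M.grade p →
        (∀ a : V.carrier, ∀ x ∈ W, M.toTwModule.oactL 0 a x ∈ W) →
        W = ⊥ ∨ W = M.grade p)) ∧
    (∀ p q : ℚ, 0 ≤ p → p ≤ nval T l i → 0 ≤ q → q ≤ nval T l i → p ≠ q →
      M.grade p ≠ ⊥ → M.grade q ≠ ⊥ →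
      ¬ ∃ f : (M.grade p) ≃ₗ[ℂ] (M.grade q),
        ∀ (a : V.carrier) (x y : M.grade p),
          (y : M.carrier) = M.toTwModule.oactL 0 a (x : M.carrier) →
          ((f y : M.carrier) = M.toTwModule.oactL 0 a ((f x : M.carrier)))) := by
  refine ⟨fun p _ _ => ⟨fun a x hx => M.oactL_zero_mem_grade a hx, fun _ W hW hinv =>
    M.eq_bot_or_eq_grade hT hg hsimp hW hinv⟩, ?_⟩
  rintro p q - - - - hpq hp hq ⟨f, hf⟩
  obtain ⟨c, hc⟩ := M.exists_act_conformal_eq_smul hT hg hsimp hp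
  obtain ⟨x, hx, hx0⟩ := Submodule.exists_mem_ne_zero_of_ne_bot hp
  have hx' : f ⟨x, hx⟩ ≠ 0 := by simpa [Subtype.ext_iff] using hx0
  have h := hf V.conformal ⟨x, hx⟩ (c • ⟨x, hx⟩) (by simp [M.oactL_conformal, hc x hx])
  rw [M.oactL_conformal, M.act_conformal_eq_smul_of_eq_smul hT hg hsimp hp hc (f ⟨x, hx⟩).2,
    map_smul, Submodule.coe_smul, add_smul, left_eq_add, smul_eq_zero] at h
  rcases h with h | h
  · exact hpq (sub_eq_zero.1 (by exact_mod_cast h)).symm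
  · exact hx' (Subtype.ext h)

end DLM
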